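/- arXiv:2109.05702 — 3 statements merged into one kernel-verified Lean document; each statement's English description precedes it below -/
import Mathlib

section
/- Fix λ_w > 0 and set μ = 1, p = 1/(λ_w+1). For x > 0 define q(x) = 1/(x+λ_w+1), a(x) = x+λ_w, b(x) = (x+λ_w)/λ_w, c(x) = (λ_w+1)/(x+λ_w+1), v(x) = log(a(x)·log(b(x)·c(x))/log(1/c(x)))/log(b(x)), and F(x) = p^{v(x)}·q(x)^{1−v(x)} + (1−p)^{v(x)}·(1−q(x))^{1−v(x)}. Then F(x) → 1 as x → 0 from the right. -/
open Real Filter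

theorem tendsto_log_add_div_div {k : ℝ} (hk : 0 < k) :
    Tendsto (fun x : ℝ => Real.log ((x + k) / k) / x) (nhdsWithin 0 (Set.Ioi 0)) (nhds k⁻¹) := by
  refine (Real.hasDerivAt_log hk.ne').tendsto_slope_zero_right.congr' ?_
  filter_upwards [self_mem_nhdsWithin] with x (hx : 0 < x)
  rw [Real.log_div (by positivity) hk.ne', add_comm k x, smul_eq_mul, div_eq_inv_mul]

theorem rpow_mul_rpow_one_sub {s t : ℝ} (hs : 0 < s) (ht : 0 < t) (v : ℝ) :
    s ^ v * t ^ (1 - v) = t * Real.exp (v * Real.log (s / t)) := by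
  rw [Real.rpow_sub ht, Real.rpow_one, Real.log_div hs.ne' ht.ne', mul_sub, Real.exp_sub,
    Real.rpow_def_of_pos hs, Real.rpow_def_of_pos ht, mul_comm v, mul_comm v]
  ring

theorem stmt_11 (lw : ℝ) (hw : 0 < lw)
    (p : ℝ) (hp : p = 1 / (lw + 1))
    (q a b c v F : ℝ → ℝ)
    (hq : ∀ x, q x = 1 / (x + lw + 1))
    (ha : ∀ x, a x = x + lw) (hb : ∀ x, b x = (x + lw) / lw)
    (hc : ∀ x, c x = (lw + 1) / (x + lw + 1))
    (hv : ∀ x, v x = Real.log (a x * Real.log (b x * c x) / Real.log (1 / c x))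
        / Real.log (b x))
    (hF : ∀ x, F x = p ^ v x * q x ^ (1 - v x) + (1 - p) ^ v x * (1 - q x) ^ (1 - v x)) :
    Tendsto F (nhdsWithin 0 (Set.Ioi 0)) (nhds 1) := by
  have hw1 : 0 < lw + 1 := by linarith
  set L : ℝ → ℝ := fun x => Real.log ((x + lw) / lw)
  set M : ℝ → ℝ := fun x => Real.log ((x + (lw + 1)) / (lw + 1))
  have hLt : Tendsto (fun x => L x / x) (nhdsWithin 0 (Set.Ioi 0)) (nhds lw⁻¹) :=
    tendsto_log_add_div_div hw
  have hMt : Tendsto (fun x => M x / x) (nhdsWithin 0 (Set.Ioi 0)) (nhds (lw + 1)⁻¹) :=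
    tendsto_log_add_div_div hw1
  have hid : Tendsto (fun x : ℝ => x) (nhdsWithin 0 (Set.Ioi 0)) (nhds 0) :=
    tendsto_nhdsWithin_of_tendsto_nhds tendsto_id
  have hR : Tendsto (fun x => Real.log ((x + lw) * (L x / x - M x / x) / (M x / x)))
      (nhdsWithin 0 (Set.Ioi 0)) (nhds 0) := by
    have h := ((hid.add_const lw).mul (hLt.sub hMt)).div hMt (by positivity)
    have e : (0 + lw) * (lw⁻¹ - (lw + 1)⁻¹) / (lw + 1)⁻¹ = 1 := by
      field_simp
      ring
    rw [e] at h
    simpa using h.log one_ne_zero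
  have hML : Tendsto (fun x => (M x / x) / (L x / x)) (nhdsWithin 0 (Set.Ioi 0))
      (nhds ((lw + 1)⁻¹ / lw⁻¹)) := hMt.div hLt (by positivity)
  have h1 := hR.mul hML
  have h2 := hR.mul (hML.sub_const 1)
  rw [zero_mul] at h1 h2
  have hqt : Tendsto (fun x => 1 / (x + lw + 1)) (nhdsWithin 0 (Set.Ioi 0))
      (nhds (1 / (0 + lw + 1))) :=
    tendsto_const_nhds.div ((hid.add_const lw).add_const 1) (by positivity)
  have h := (hqt.mul ((Real.continuous_exp.tendsto 0).comp h1)).add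
    ((hqt.const_sub 1).mul ((Real.continuous_exp.tendsto 0).comp h2))
  rw [Real.exp_zero, mul_one, mul_one, add_sub_cancel] at h
  refine h.congr' ?_
  filter_upwards [self_mem_nhdsWithin] with x (hx : 0 < x)
  have hLpos : 0 < L x := Real.log_pos (by rw [one_lt_div hw]; linarith)
  have hMpos : 0 < M x := Real.log_pos (by rw [one_lt_div hw1]; linarith)
  have hlogc : Real.log (1 / c x) = M x := by
    rw [hc, one_div_div, add_assoc]
  have hlogb : Real.log (b x) = L x := by rw [hb]
  have hlogbc : Real.log (b x * c x) = L x - M x := by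
    have hc0 : c x ≠ 0 := by rw [hc]; positivity
    have hb0 : b x ≠ 0 := by rw [hb]; positivity
    rw [Real.log_mul hb0 hc0, hlogb, ← hlogc, one_div, Real.log_inv, sub_neg_eq_add]
  have hlogpq : Real.log (p / q x) = M x := by
    rw [← hlogc, hp, hq, hc]
    congr 1
    field_simp
  have hp1 : 1 - p = lw / (lw + 1) := by rw [hp]; field_simp; ring
  have hq1 : 1 - q x = (x + lw) / (x + lw + 1) := by rw [hq]; field_simp; ring
  have hpq1 : (1 - p) / (1 - q x) = ((x + (lw + 1)) / (lw + 1)) / ((x + lw) / lw) := by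
    rw [hp1, hq1]; field_simp; ring
  have hlogpq1 : Real.log ((1 - p) / (1 - q x)) = M x - L x := by
    rw [hpq1, Real.log_div (by positivity) (by positivity)]
  have hvx : v x = Real.log ((x + lw) * (L x / x - M x / x) / (M x / x)) / L x := by
    rw [hv, hlogbc, hlogc, hlogb, ha]
    congr 2
    field_simp
  rw [hF, rpow_mul_rpow_one_sub (by rw [hp]; positivity) (by rw [hq]; positivity),
    rpow_mul_rpow_one_sub (by rw [hp1]; positivity) (by rw [hq1]; positivity), hlogpq1, hlogpq,
    hvx, hq]
  simp only [Function.comp_apply]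
  congr 3 <;> field_simp
end

section
/- Fix λ_w > 0 and set μ = 1, p = 1/(λ_w+1). For x > 0 define q(x) = 1/(x+λ_w+1), v(x) = log((x+λ_w)·log(b(x)·c(x))/log(1/c(x)))/log(b(x)) with b(x) = (x+λ_w)/λ_w and c(x) = (λ_w+1)/(x+λ_w+1), and F(x) = p^{v(x)}·q(x)^{1−v(x)} + (1−p)^{v(x)}·(1−q(x))^{1−v(x)}. Then F is differentiable on a right neighborhood of 0 and F′(x) → 0 as x → 0 from the right. -/
open Real Filter

/-- The quotient `log (1 + t) / t` extends analytically to `t = 0`, with the expected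
first-order expansion. -/
lemma exists_analyticAt_log_one_add_eq_mul :
    ∃ g : ℝ → ℝ, AnalyticAt ℝ g 0 ∧ g 0 = 1 ∧ HasDerivAt g (-1 / 2) 0 ∧
      ∀ t, Real.log (1 + t) = t * g t := by
  set f : ℝ → ℝ := fun t => Real.log (1 + t) with hf
  have hfd : ∀ t : ℝ, 1 + t ≠ 0 → HasDerivAt f (1 / (1 + t)) t := fun t ht =>
    ((hasDerivAt_id t).const_add 1).log ht
  have hfa : AnalyticAt ℝ f 0 := (analyticAt_const.add analyticAt_id).log (by simp)
  have hga : AnalyticAt ℝ (dslope f 0) 0 := by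
    obtain ⟨s, hs⟩ := hfa
    exact ⟨_, hs.has_fpower_series_dslope_fslope⟩
  have hmul : ∀ t, f t = t * dslope f 0 t := fun t => by
    have h := sub_smul_dslope f 0 t
    simp only [sub_zero, smul_eq_mul] at h
    rw [h]
    simp [hf]
  refine ⟨dslope f 0, hga, ?_, ?_, hmul⟩
  · rw [dslope_same, (hfd 0 (by simp)).deriv]
    simp
  have hderiv : (fun t => dslope f 0 t + t * deriv (dslope f 0) t)
      =ᶠ[nhds 0] fun t => 1 / (1 + t) := by
    have hne : ∀ᶠ t : ℝ in nhds 0, 1 + t ≠ 0 :=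
      (by fun_prop : ContinuousAt (fun t : ℝ => 1 + t) 0).eventually_ne (by simp)
    filter_upwards [hne, hga.eventually_analyticAt] with t ht hgt
    have h := (hasDerivAt_id t).mul hgt.differentiableAt.hasDerivAt
    have h' : HasDerivAt f (1 * dslope f 0 t + id t * deriv (dslope f 0) t) t :=
      h.congr_of_eventuallyEq (Eventually.of_forall hmul)
    simpa using h'.unique (hfd t ht)
  have h1 := (hga.differentiableAt.hasDerivAt.add
    ((hasDerivAt_id (0 : ℝ)).mul hga.deriv.differentiableAt.hasDerivAt))
  have h2 : HasDerivAt (fun t : ℝ => 1 / (1 + t)) (-1) 0 := by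
    simpa using ((hasDerivAt_id (0 : ℝ)).const_add 1).fun_inv (by simp)
  have h3 := (h2.congr_of_eventuallyEq hderiv).unique h1
  have h4 : deriv (dslope f 0) 0 = -1 / 2 := by
    simp only [id, one_mul, zero_mul, add_zero] at h3
    linarith
  exact h4 ▸ hga.differentiableAt.hasDerivAt

/-- The quotient `log ((x + k) / k) / x` extends analytically to `x = 0`, with the expected
first-order expansion. -/
lemma exists_analyticAt_log_add_div_eq_mul {k : ℝ} (hk : k ≠ 0) :
    ∃ l : ℝ → ℝ, AnalyticAt ℝ l 0 ∧ l 0 = 1 / k ∧ HasDerivAt l (-1 / (2 * k ^ 2)) 0 ∧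
      ∀ x, Real.log ((x + k) / k) = x * l x := by
  obtain ⟨g, hga, hg0, hgd, hg⟩ := exists_analyticAt_log_one_add_eq_mul
  have hdiv : HasDerivAt (fun x : ℝ => x / k) (1 / k) 0 := (hasDerivAt_id 0).div_const k
  refine ⟨fun x => g (x / k) / k, ?_, by simp [hg0], ?_, fun x => ?_⟩
  · have hga' : AnalyticAt ℝ g ((fun x : ℝ => x / k) 0) := by simpa using hga
    exact (hga'.comp (f := fun x : ℝ => x / k) (analyticAt_id.div analyticAt_const hk)).div
      analyticAt_const hk
  · have hgd' : HasDerivAt g (-1 / 2) ((fun x : ℝ => x / k) 0) := by simpa using hgd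
    refine ((hgd'.comp 0 hdiv).div_const k).congr_deriv ?_
    field_simp
  · rw [show (x + k) / k = 1 + x / k by field_simp; ring, hg]
    ring

/-- At the tilting exponent `v = log u / (L + M)` the two summands share the factor
`exp (L * v)`. -/
lemma rpow_mul_rpow_add_rpow_mul_rpow {p q r s L M u : ℝ} (hp : 0 < p) (hq : 0 < q)
    (hr : 0 < r) (hs : 0 < s) (hu : 0 < u) (hLM : L + M ≠ 0)
    (hpq : Real.log p = Real.log q + L) (hrs : Real.log r = Real.log s - M) :
    p ^ (Real.log u / (L + M)) * q ^ (1 - Real.log u / (L + M)) +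
      r ^ (Real.log u / (L + M)) * s ^ (1 - Real.log u / (L + M)) =
      (q + s / u) * Real.exp (L * (Real.log u / (L + M))) := by
  set v := Real.log u / (L + M) with hv
  have huv : Real.log u = (L + M) * v := by rw [hv]; field_simp
  have h1 : p ^ v * q ^ (1 - v) = q * Real.exp (L * v) := by
    rw [rpow_def_of_pos hp, rpow_def_of_pos hq, ← Real.exp_add, hpq]
    nth_rw 3 [← Real.exp_log hq]
    rw [← Real.exp_add]
    ring_nf
  have h2 : r ^ v * s ^ (1 - v) = s / u * Real.exp (L * v) := by
    rw [rpow_def_of_pos hr, rpow_def_of_pos hs, ← Real.exp_add, hrs]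
    nth_rw 3 [← Real.exp_log hs]
    nth_rw 1 [← Real.exp_log hu]
    rw [huv, ← Real.exp_sub, ← Real.exp_add]
    ring_nf
  rw [h1, h2]
  ring

theorem stmt_13 (lw : ℝ) (hw : 0 < lw)
    (p : ℝ) (hp : p = 1 / (lw + 1))
    (q b c v F : ℝ → ℝ)
    (hq : ∀ x, q x = 1 / (x + lw + 1))
    (hb : ∀ x, b x = (x + lw) / lw)
    (hc : ∀ x, c x = (lw + 1) / (x + lw + 1))
    (hv : ∀ x, v x = Real.log ((x + lw) * Real.log (b x * c x) / Real.log (1 / c x))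
        / Real.log (b x))
    (hF : ∀ x, F x = p ^ v x * q x ^ (1 - v x) + (1 - p) ^ v x * (1 - q x) ^ (1 - v x)) :
    (∃ δ > (0 : ℝ), ∀ x ∈ Set.Ioo (0 : ℝ) δ, DifferentiableAt ℝ F x) ∧
      Tendsto (deriv F) (nhdsWithin 0 (Set.Ioi 0)) (nhds 0) := by
  have hw1 : 0 < lw + 1 := by positivity
  obtain ⟨β, hβa, hβ0, hβd, hβ⟩ := exists_analyticAt_log_add_div_eq_mul hw.ne'
  obtain ⟨l, hla, hl0, hld, hl⟩ := exists_analyticAt_log_add_div_eq_mul hw1.ne'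
  have hm0 : β 0 - l 0 ≠ 0 := by
    rw [hβ0, hl0, show 1 / lw - 1 / (lw + 1) = 1 / (lw * (lw + 1)) by field_simp; ring]
    positivity
  have hu0 : (0 + lw) * (β 0 - l 0) / l 0 = 1 := by
    rw [hβ0, hl0]
    field_simp
    ring
  set G : ℝ → ℝ := fun x => β x / ((x + lw + 1) * (β x - l x)) *
    Real.exp (l x / β x * Real.log ((x + lw) * (β x - l x) / l x)) with hG
  have hFG : ∀ x, 0 < x → F x = G x := fun x hx => by
    have hL : Real.log (1 / c x) = x * l x := by
      rw [← hl, hc]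
      congr 1
      field_simp
      ring
    have hB : Real.log (b x) = x * β x := by rw [← hβ, hb]
    have hc0 : 0 < c x := by rw [hc]; positivity
    have hb0 : 0 < b x := by rw [hb]; positivity
    have hlogc : Real.log (c x) = -(x * l x) := by
      rw [← hL, one_div, Real.log_inv, neg_neg]
    have hM : Real.log (b x * c x) = x * β x - x * l x := by
      rw [Real.log_mul hb0.ne' hc0.ne', hB, hlogc]
      ring
    have hLpos : 0 < x * l x := by
      rw [← hL, hc]
      apply Real.log_pos
      rw [one_div_div, lt_div_iff₀ hw1]
      linarith
    have hMpos : 0 < x * β x - x * l x := by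
      rw [← hM, hb, hc]
      apply Real.log_pos
      rw [div_mul_div_comm, lt_div_iff₀ (by positivity)]
      nlinarith
    have hlpos : 0 < l x := pos_of_mul_pos_right hLpos hx.le
    have hmpos : 0 < β x - l x := by
      rw [← mul_sub] at hMpos
      exact pos_of_mul_pos_right hMpos hx.le
    have hβpos : 0 < β x := by linarith
    have hu : (x + lw) * (x * β x - x * l x) / (x * l x) = (x + lw) * (β x - l x) / l x := by
      field_simp
    have hp0 : 0 < p := by rw [hp]; positivity
    have hq0 : 0 < q x := by rw [hq]; positivity
    have hp' : 1 - p = lw / (lw + 1) := by rw [hp]; field_simp; ring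
    have hq' : 1 - q x = (x + lw) / (x + lw + 1) := by rw [hq]; field_simp; ring
    have hp'0 : 0 < 1 - p := by rw [hp']; positivity
    have hq'0 : 0 < 1 - q x := by rw [hq']; positivity
    have hpc : p * c x = q x := by rw [hp, hc, hq]; field_simp
    have hbc : (1 - p) * (b x * c x) = 1 - q x := by
      rw [hp', hb, hc, hq']; field_simp
    have hpq : Real.log p = Real.log (q x) + x * l x := by
      rw [← hpc, Real.log_mul hp0.ne' hc0.ne', hlogc]
      ring
    have hrs : Real.log (1 - p) = Real.log (1 - q x) - (x * β x - x * l x) := by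
      rw [← hbc, Real.log_mul hp'0.ne' (by positivity), hM]
      ring
    have hsum : x * β x = x * l x + (x * β x - x * l x) := by ring
    rw [hF, hv, hL, hM, hB, hu]
    nth_rw 1 2 3 4 [hsum]
    rw [rpow_mul_rpow_add_rpow_mul_rpow hp0 hq0 hp'0 hq'0 (by positivity) (by linarith)
      hpq hrs, ← hsum, hq', hq, hG]
    have hexp : x * l x * (Real.log ((x + lw) * (β x - l x) / l x) / (x * β x)) =
        l x / β x * Real.log ((x + lw) * (β x - l x) / l x) := by field_simp
    rw [hexp]
    dsimp only
    congr 1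
    field_simp
    ring
  have hl0' : l 0 ≠ 0 := by rw [hl0]; positivity
  have hβ0' : β 0 ≠ 0 := by rw [hβ0]; positivity
  have hden : (0 + lw + 1) * (β 0 - l 0) ≠ 0 := mul_ne_zero (by positivity) hm0
  have hGa : AnalyticAt ℝ G 0 := by
    have hid : AnalyticAt ℝ (fun x : ℝ => x) 0 := analyticAt_id
    refine (hβa.div (((hid.add analyticAt_const).add analyticAt_const).mul
      (hβa.sub hla)) hden).mul (((hla.div hβa hβ0').mul (AnalyticAt.log
        (((hid.add analyticAt_const).mul (hβa.sub hla)).div hla hl0') ?_)).rexp')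
    show 0 < (0 + lw) * (β 0 - l 0) / l 0
    rw [hu0]
    exact one_pos
  have hG0 : deriv G 0 = 0 := by
    have hid : HasDerivAt (fun x : ℝ => x) 1 0 := hasDerivAt_id 0
    have h := (hβd.div (((hid.add_const lw).add_const 1).mul (hβd.sub hld)) hden).mul
      (((hld.div hβd hβ0').mul ((((hid.add_const lw).mul (hβd.sub hld)).div hld hl0').log
        (by simp only [Pi.div_apply, Pi.mul_apply, Pi.sub_apply, hu0]; exact one_ne_zero))).exp)
    refine Eq.trans (HasDerivAt.deriv h) ?_
    simp only [Pi.div_apply, Pi.mul_apply, Pi.sub_apply, hu0, Real.log_one, mul_zero,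
      Real.exp_zero]
    simp only [hβ0, hl0]
    have hne : 1 / lw - 1 / (lw + 1) = 1 / (lw * (lw + 1)) := by field_simp; ring
    rw [hne]
    field_simp
    ring
  have hev : ∀ x, 0 < x → F =ᶠ[nhds x] G := fun x hx => by
    filter_upwards [lt_mem_nhds hx] with y hy using hFG y hy
  constructor
  · obtain ⟨δ, hδ, hball⟩ := Metric.eventually_nhds_iff.mp hGa.eventually_analyticAt
    refine ⟨δ, hδ, fun x hx => ?_⟩
    refine (hball ?_).differentiableAt.congr_of_eventuallyEq (hev x hx.1)
    rw [Real.dist_eq, sub_zero, abs_of_pos hx.1]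
    exact hx.2
  · have hlim : Tendsto (deriv G) (nhdsWithin 0 (Set.Ioi 0)) (nhds 0) := by
      have := hGa.deriv.continuousAt.tendsto
      rw [hG0] at this
      exact this.mono_left nhdsWithin_le_nhds
    refine hlim.congr' ?_
    filter_upwards [self_mem_nhdsWithin] with x hx using (hev x hx).deriv_eq.symm
end

section
/- Fix λ_w > 0 and set μ = 1, p = 1/(λ_w+1). For x > 0 define q(x) = 1/(x+λ_w+1), v(x) = log((x+λ_w)·log(b(x)·c(x))/log(1/c(x)))/log(b(x)) with b(x) = (x+λ_w)/λ_w and c(x) = (λ_w+1)/(x+λ_w+1), F(x) = p^{v(x)}·q(x)^{1−v(x)} + (1−p)^{v(x)}·(1−q(x))^{1−v(x)}, and I_err(x) = −log F(x). Then I_err(x)/x² → 1/(8·λ_w·(λ_w+1)²) as x → 0 from the right. -/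
open Real Filter

/-- A function with a cubic remainder at `0` is `t + t ^ 2 * k t` with `k t → c`. -/
lemma exists_quadratic_factor {f : ℝ → ℝ} {c C : ℝ}
    (hf : ∀ t, |t| ≤ 1 / 2 → |f t - t - c * t ^ 2| ≤ C * |t| ^ 3) :
    ∃ k : ℝ → ℝ, Tendsto k (nhds 0) (nhds c) ∧ ∀ t, f t = t + t ^ 2 * k t := by
  have h0 : f 0 = 0 := by
    have := hf 0 (by norm_num)
    simpa using this
  refine ⟨fun t => if t = 0 then c else (f t - t) / t ^ 2, ?_, ?_⟩
  · rw [tendsto_iff_norm_sub_tendsto_zero]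
    have hlim : Tendsto (fun t : ℝ => |C| * |t|) (nhds 0) (nhds 0) := by
      have : Continuous fun t : ℝ => |C| * |t| := by fun_prop
      simpa using this.tendsto 0
    refine squeeze_zero' (Eventually.of_forall fun _ => norm_nonneg _) ?_ hlim
    filter_upwards [Metric.closedBall_mem_nhds (0 : ℝ) (by norm_num : (0 : ℝ) < 1 / 2)] with t ht
    have ht' : |t| ≤ 1 / 2 := by simpa using ht
    by_cases h : t = 0
    · simp [h]
    · have hpos : 0 < |t| := abs_pos.mpr h
      have e : (f t - t) / t ^ 2 - c = (f t - t - c * t ^ 2) / t ^ 2 := by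
        field_simp
      rw [if_neg h, e, Real.norm_eq_abs, abs_div, abs_pow, div_le_iff₀ (by positivity)]
      calc |f t - t - c * t ^ 2| ≤ C * |t| ^ 3 := hf t ht'
        _ ≤ |C| * |t| ^ 3 := by gcongr; exact le_abs_self C
        _ = |C| * |t| * |t| ^ 2 := by ring
  · intro t
    by_cases h : t = 0
    · simp [h, h0]
    · simp only [if_neg h]
      field_simp
      ring

lemma exists_log_one_add_eq :
    ∃ k : ℝ → ℝ, Tendsto k (nhds 0) (nhds (-1 / 2)) ∧
      ∀ t, Real.log (1 + t) = t + t ^ 2 * k t := by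
  refine exists_quadratic_factor (C := 2) fun t ht => ?_
  have h := Real.abs_log_sub_add_sum_range_le (x := -t) (by rw [abs_neg]; linarith) 2
  rw [abs_neg] at h
  norm_num [Finset.sum_range_succ] at h
  calc |Real.log (1 + t) - t - -1 / 2 * t ^ 2|
      = |-t + t ^ 2 / 2 + Real.log (1 + t)| := by congr 1; ring
    _ ≤ |t| ^ 3 / (1 - |t|) := h
    _ ≤ 2 * |t| ^ 3 := by
      rw [div_le_iff₀ (by linarith)]
      nlinarith [pow_nonneg (abs_nonneg t) 3]

lemma exists_exp_sub_one_eq :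
    ∃ k : ℝ → ℝ, Tendsto k (nhds 0) (nhds (1 / 2)) ∧
      ∀ t, Real.exp t - 1 = t + t ^ 2 * k t := by
  refine exists_quadratic_factor (C := 2 / 9) fun t ht => ?_
  have h := Real.exp_bound (x := t) (by linarith) (n := 3) (by norm_num)
  norm_num [Finset.sum_range_succ, Nat.factorial] at h
  calc |Real.exp t - 1 - t - 1 / 2 * t ^ 2|
      = |Real.exp t - (1 + t + t ^ 2 / 2)| := by congr 1; ring
    _ ≤ _ := h
    _ = 2 / 9 * |t| ^ 3 := by ring

lemma tendsto_log_one_add_div_self {a : ℝ} (ha : 0 < a) :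
    Tendsto (fun x => Real.log (1 + x / a) / x) (nhdsWithin 0 (Set.Ioi 0)) (nhds (1 / a)) := by
  obtain ⟨k, hk, hlog⟩ := exists_log_one_add_eq
  have hx : Tendsto (fun x : ℝ => x) (nhdsWithin 0 (Set.Ioi 0)) (nhds 0) := nhdsWithin_le_nhds
  have hxa : Tendsto (fun x : ℝ => x / a) (nhdsWithin 0 (Set.Ioi 0)) (nhds 0) := by
    simpa using hx.div_const a
  have h := (hx.mul ((hk.comp hxa).div_const (a ^ 2))).const_add (1 / a)
  rw [zero_mul, add_zero] at h
  refine h.congr' ?_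
  filter_upwards [self_mem_nhdsWithin] with x (hx0 : 0 < x)
  simp only [Function.comp, hlog]
  field_simp

lemma tendsto_add_mul_log_sub_div_sq {a : ℝ} (ha : 0 < a) :
    Tendsto (fun x => ((x + a) * Real.log (1 + x / a) - x) / x ^ 2)
      (nhdsWithin 0 (Set.Ioi 0)) (nhds (1 / (2 * a))) := by
  obtain ⟨k, hk, hlog⟩ := exists_log_one_add_eq
  have hx : Tendsto (fun x : ℝ => x) (nhdsWithin 0 (Set.Ioi 0)) (nhds 0) := nhdsWithin_le_nhds
  have hxa : Tendsto (fun x : ℝ => x / a) (nhdsWithin 0 (Set.Ioi 0)) (nhds 0) := by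
    simpa using hx.div_const a
  have h := ((hx.add_const a).mul ((hk.comp hxa).div_const (a ^ 2))).const_add (1 / a)
  have e : 1 / a + (0 + a) * (-1 / 2 / a ^ 2) = 1 / (2 * a) := by
    field_simp; ring
  rw [e] at h
  refine h.congr' ?_
  filter_upwards [self_mem_nhdsWithin] with x (hx0 : 0 < x)
  simp only [Function.comp, hlog]
  field_simp
  ring

/-- If `(u - 1) / g → a` and `u → 1`, then `log u / g → a`. -/
lemma tendsto_log_div {l : Filter ℝ} {u g : ℝ → ℝ} {a : ℝ} (hu : Tendsto u l (nhds 1))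
    (h : Tendsto (fun x => (u x - 1) / g x) l (nhds a)) :
    Tendsto (fun x => Real.log (u x) / g x) l (nhds a) := by
  obtain ⟨k, hk, hlog⟩ := exists_log_one_add_eq
  have hu0 : Tendsto (fun x => u x - 1) l (nhds 0) := by simpa using hu.sub_const 1
  have h2 := h.mul ((hu0.mul (hk.comp hu0)).const_add 1)
  rw [zero_mul, add_zero, mul_one] at h2
  refine h2.congr fun x => ?_
  have := hlog (u x - 1)
  rw [add_sub_cancel] at this
  rw [this]
  simp only [Function.comp]
  ring

/-- A function that is `1 + O(g)` with `g → 0` and `g ≠ 0` tends to `1`. -/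
lemma tendsto_one_of_sub_one_div {l : Filter ℝ} {u g : ℝ → ℝ} {a : ℝ}
    (hg : Tendsto g l (nhds 0)) (hg0 : ∀ᶠ x in l, g x ≠ 0)
    (h : Tendsto (fun x => (u x - 1) / g x) l (nhds a)) : Tendsto u l (nhds 1) := by
  have h2 := (h.mul hg).const_add 1
  rw [mul_zero, add_zero] at h2
  refine h2.congr' ?_
  filter_upwards [hg0] with x hx
  field_simp
  ring

theorem stmt_15 (lw : ℝ) (hw : 0 < lw)
    (p : ℝ) (hp : p = 1 / (lw + 1))
    (q b c v F Ierr : ℝ → ℝ)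
    (hq : ∀ x, q x = 1 / (x + lw + 1))
    (hb : ∀ x, b x = (x + lw) / lw)
    (hc : ∀ x, c x = (lw + 1) / (x + lw + 1))
    (hv : ∀ x, v x = Real.log ((x + lw) * Real.log (b x * c x) / Real.log (1 / c x))
        / Real.log (b x))
    (hF : ∀ x, F x = p ^ v x * q x ^ (1 - v x) + (1 - p) ^ v x * (1 - q x) ^ (1 - v x))
    (hI : ∀ x, Ierr x = -Real.log (F x)) :
    Tendsto (fun x => Ierr x / x ^ 2) (nhdsWithin 0 (Set.Ioi 0))
      (nhds (1 / (8 * lw * (lw + 1) ^ 2))) := by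
  have hw1 : 0 < lw + 1 := by linarith
  have hx : Tendsto (fun x : ℝ => x) (nhdsWithin 0 (Set.Ioi 0)) (nhds 0) := nhdsWithin_le_nhds
  have hxne : ∀ᶠ x : ℝ in nhdsWithin 0 (Set.Ioi 0), x ≠ 0 := by
    filter_upwards [self_mem_nhdsWithin] with x (hx0 : 0 < x) using hx0.ne'
  set L : ℝ → ℝ := fun x => Real.log (1 + x / lw) with hL
  set B : ℝ → ℝ := fun x => Real.log (1 + x / (lw + 1)) with hB
  have hLx : Tendsto (fun x => L x / x) _ _ := tendsto_log_one_add_div_self hw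
  have hBx : Tendsto (fun x => B x / x) _ _ := tendsto_log_one_add_div_self hw1
  have hBpos : ∀ x, 0 < x → 0 < B x := fun x hx0 =>
    Real.log_pos (by have : 0 < x / (lw + 1) := by positivity
                     linarith)
  have hLpos : ∀ x, 0 < x → 0 < L x := fun x hx0 =>
    Real.log_pos (by have : 0 < x / lw := by positivity
                     linarith)
  have hlogb : ∀ x, Real.log (b x) = L x := fun x => by
    rw [hb, hL]; congr 1; field_simp; ring
  have hcinv : ∀ x, 1 / c x = 1 + x / (lw + 1) := fun x => by
    rw [hc, one_div_div]; field_simp; ring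
  have hlogbc : ∀ x, 0 < x → Real.log (b x * c x) = L x - B x := fun x hx0 => by
    have hb0 : b x ≠ 0 := by rw [hb]; positivity
    have hc0 : c x ≠ 0 := by rw [hc]; positivity
    rw [Real.log_mul hb0 hc0, hlogb, sub_eq_add_neg, hB]
    simp only
    rw [← hcinv, one_div, Real.log_inv, neg_neg]
  have hD : Tendsto (fun x => ((x + lw) * L x - (x + (lw + 1)) * B x) / x ^ 2)
      (nhdsWithin 0 (Set.Ioi 0)) (nhds (1 / (2 * lw * (lw + 1)))) := by
    have h := (tendsto_add_mul_log_sub_div_sq hw).sub (tendsto_add_mul_log_sub_div_sq hw1)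
    have e : 1 / (2 * lw) - 1 / (2 * (lw + 1)) = 1 / (2 * lw * (lw + 1)) := by
      field_simp; ring
    rw [e] at h
    refine h.congr fun x => ?_
    rw [← sub_div]; congr 1; simp only [hL, hB]; ring
  have hvlim : Tendsto v (nhdsWithin 0 (Set.Ioi 0)) (nhds (1 / 2)) := by
    have hR : Tendsto (fun x => ((x + lw) * (L x - B x) / B x - 1) / x)
        (nhdsWithin 0 (Set.Ioi 0)) (nhds (1 / (2 * lw))) := by
      have h := hD.div hBx (by positivity)
      have e : 1 / (2 * lw * (lw + 1)) / (1 / (lw + 1)) = 1 / (2 * lw) := by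
        field_simp
      rw [e] at h
      refine h.congr' ?_
      filter_upwards [self_mem_nhdsWithin] with x (hx0 : 0 < x)
      have := hBpos x hx0
      simp only [Pi.div_apply]
      field_simp
      ring
    have h := (tendsto_log_div (tendsto_one_of_sub_one_div hx hxne hR) hR).div hLx
      (by positivity)
    have e : 1 / (2 * lw) / (1 / lw) = 1 / 2 := by field_simp
    rw [e] at h
    refine h.congr' ?_
    filter_upwards [self_mem_nhdsWithin] with x (hx0 : 0 < x)
    have := hLpos x hx0
    rw [hv, hlogbc x hx0, hlogb, hcinv]
    simp only [Pi.div_apply]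
    change _ / _ / _ = Real.log ((x + lw) * (L x - B x) / B x) / L x
    field_simp
  have hFexp : ∀ x, 0 < x → F x =
      q x * Real.exp (v x * B x) + (1 - q x) * Real.exp (-(v x * (L x - B x))) := by
    intro x hx0
    have hq0 : 0 < q x := by rw [hq]; positivity
    have hq1 : 1 - q x = (x + lw) / (x + lw + 1) := by rw [hq]; field_simp; ring
    have hq1' : 0 < 1 - q x := by rw [hq1]; positivity
    have hpe : p = q x * Real.exp (B x) := by
      rw [hB]; simp only
      rw [Real.exp_log (by positivity), hq, hp]; field_simp; ring
    have hpe' : 1 - p = (1 - q x) * Real.exp (-(L x - B x)) := by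
      rw [neg_sub, Real.exp_sub, hB, hL]; simp only
      rw [Real.exp_log (by positivity), Real.exp_log (by positivity), hq1, hp]
      field_simp; ring
    have key : ∀ r y : ℝ, 0 < r →
        (r * Real.exp y) ^ v x * r ^ (1 - v x) = r * Real.exp (v x * y) := fun r y hr => by
      rw [Real.mul_rpow hr.le (Real.exp_pos _).le, mul_right_comm, ← Real.rpow_add hr,
        add_sub_cancel, Real.rpow_one, ← Real.exp_mul, mul_comm y]
    rw [hF, hpe', key _ _ hq1', hpe, key _ _ hq0, mul_neg]
  obtain ⟨k, hk, hexp⟩ := exists_exp_sub_one_eq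
  have hqlim : Tendsto q (nhdsWithin 0 (Set.Ioi 0)) (nhds (1 / (lw + 1))) := by
    have h := (tendsto_const_nhds (x := (1 : ℝ))).div (hx.add_const (lw + 1)) (by simpa using hw1.ne')
    rw [zero_add] at h
    refine h.congr fun x => ?_
    simp [hq, add_assoc]
  have hMx := hLx.sub hBx
  have hto : ∀ {g : ℝ → ℝ} {a : ℝ},
      Tendsto (fun x => g x / x) (nhdsWithin 0 (Set.Ioi 0)) (nhds a) →
      Tendsto g (nhdsWithin 0 (Set.Ioi 0)) (nhds 0) := fun {g a} h => by
    have h2 := h.mul hx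
    rw [mul_zero] at h2
    refine h2.congr' ?_
    filter_upwards [hxne] with x hx0
    field_simp
  have hα : Tendsto (fun x => v x * B x) (nhdsWithin 0 (Set.Ioi 0)) (nhds 0) := by
    simpa using hvlim.mul (hto hBx)
  have hβ : Tendsto (fun x => -(v x * (L x - B x))) (nhdsWithin 0 (Set.Ioi 0)) (nhds 0) := by
    simpa using (hvlim.mul ((hto hLx).sub (hto hBx))).neg
  have hFlim : Tendsto (fun x => (F x - 1) / x ^ 2) (nhdsWithin 0 (Set.Ioi 0))
      (nhds (-(1 / (8 * lw * (lw + 1) ^ 2)))) := by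
    have h := (((hvlim.mul hqlim).mul hD.neg).add
      ((hqlim.mul ((hvlim.mul hBx).pow 2)).mul (hk.comp hα))).add
      (((hqlim.const_sub 1).mul ((hvlim.mul hMx).pow 2)).mul (hk.comp hβ))
    have e : 1 / 2 * (1 / (lw + 1)) * -(1 / (2 * lw * (lw + 1))) +
        1 / (lw + 1) * (1 / 2 * (1 / (lw + 1))) ^ 2 * (1 / 2) +
        (1 - 1 / (lw + 1)) * (1 / 2 * (1 / lw - 1 / (lw + 1))) ^ 2 * (1 / 2) =
        -(1 / (8 * lw * (lw + 1) ^ 2)) := by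
      field_simp; ring
    rw [e] at h
    refine h.congr' ?_
    filter_upwards [self_mem_nhdsWithin] with x (hx0 : 0 < x)
    have h1 := hexp (v x * B x)
    have h2 := hexp (-(v x * (L x - B x)))
    rw [hFexp x hx0, eq_add_of_sub_eq h1, eq_add_of_sub_eq h2]
    simp only [Function.comp]
    have hqe : q x * (x + (lw + 1)) = 1 := by
      rw [hq]; field_simp; ring
    have hqe' : q x * (x + lw) = 1 - q x := by linarith
    have hfirst : v x * q x * -(((x + lw) * L x - (x + (lw + 1)) * B x) / x ^ 2) =
        v x * (B x - (1 - q x) * L x) / x ^ 2 := by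
      rw [← hqe']
      linear_combination (v x * B x / x ^ 2) * hqe
    rw [hfirst]
    field_simp
    ring
  have hx2 : Tendsto (fun x : ℝ => x ^ 2) (nhdsWithin 0 (Set.Ioi 0)) (nhds 0) := by
    simpa using hx.pow 2
  have hF1 := tendsto_one_of_sub_one_div hx2 (hxne.mono fun x h => pow_ne_zero 2 h) hFlim
  have h := (tendsto_log_div hF1 hFlim).neg
  rw [neg_neg] at h
  refine h.congr fun x => ?_
  rw [hI, neg_div]
end
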